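/- Let T be a tree with a vertex u having two distinct neighbors v₁ and v₂ such that v₁ has degree 1, v₂ has degree 2, and the neighbor v₂′ of v₂ other than u has degree 1. Then γ_e(T) ≤ γ_e(T − {v₁, v₂, v₂′}) + 1, where T − {v₁, v₂, v₂′} is the tree obtained from T by deleting the vertices v₁, v₂, v₂′. -/

import Mathlib

open SimpleGraph

/-- The contribution `(1/2)^(d-1)` of a vertex at `S`-restricted distance `d`,
with `(1/2)^∞ = 0`. -/
noncomputable def expStep (d : ℕ∞) : ℝ :=
  if h : d = ⊤ then 0 else (1 / 2 : ℝ) ^ ((d.untop h : ℤ) - 1)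

/-- `expDist G S u v` is the minimum number of edges of a walk in `G` from `u` to `v`
such that `v` is the only vertex of the walk belonging to `S` (i.e. the distance from `u`
to `v ∈ S` in `G - (S \ {v})`), and `⊤` if no such walk exists. -/
noncomputable def expDist {V : Type*} (G : SimpleGraph V) (S : Finset V) (u v : V) : ℕ∞ :=
  sInf {n : ℕ∞ | ∃ p : G.Walk u v, (∀ x ∈ p.support, x ∈ S → x = v) ∧ (p.length : ℕ∞) = n}

/-- The weight `w_{(G,S)}(u) = Σ_{v ∈ S} (1/2)^(dist_{(G,S)}(u,v) - 1)`. -/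
noncomputable def expWeight {V : Type*} (G : SimpleGraph V) (S : Finset V) (u : V) : ℝ :=
  ∑ v ∈ S, expStep (expDist G S u v)

/-- `S` is an exponential dominating set of `G`. -/
def IsExpDomSet {V : Type*} (G : SimpleGraph V) (S : Finset V) : Prop :=
  ∀ u : V, 1 ≤ expWeight G S u

/-- The exponential domination number of `G`. -/
noncomputable def expDomNum {V : Type*} (G : SimpleGraph V) : ℕ :=
  sInf {k : ℕ | ∃ S : Finset V, IsExpDomSet G S ∧ S.card = k}

lemma expStep_top : expStep ⊤ = 0 := by simp [expStep]

lemma expStep_coe (n : ℕ) : expStep (n : ℕ∞) = (1 / 2 : ℝ) ^ ((n : ℤ) - 1) := by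
  have h : (n : ℕ∞) ≠ ⊤ := ENat.natCast_ne_top n
  rw [expStep, dif_neg h]
  rfl

lemma expStep_zero : expStep 0 = 2 := by
  have h := expStep_coe 0
  norm_num at h
  exact h

lemma expStep_nonneg (d : ℕ∞) : 0 ≤ expStep d := by
  induction d using ENat.recTopCoe with
  | top => exact expStep_top.ge
  | coe n => rw [expStep_coe]; positivity

lemma expStep_add_one (d : ℕ∞) : expStep (d + 1) = expStep d / 2 := by
  induction d using ENat.recTopCoe with
  | top => simp [expStep_top]
  | coe n =>
    have h := expStep_coe (n + 1)
    push_cast at h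
    rw [h, expStep_coe, add_sub_right_comm, zpow_add₀ (by norm_num)]
    norm_num
    ring

lemma expStep_one : expStep 1 = 1 := by
  have h := expStep_add_one 0
  rw [zero_add, expStep_zero] at h
  linarith

lemma expStep_antitone : Antitone expStep := by
  intro a b h
  induction b using ENat.recTopCoe with
  | top => rw [expStep_top]; exact expStep_nonneg a
  | coe n =>
    lift a to ℕ using ne_top_of_le_ne_top (ENat.natCast_ne_top n) h
    rw [expStep_coe, expStep_coe]
    have h' : a ≤ n := by exact_mod_cast h
    exact zpow_le_zpow_right_of_le_one₀ (by norm_num) (by norm_num) (by lia)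

section expDist

variable {V : Type*} {G : SimpleGraph V} {S : Finset V}

lemma expDist_le {u v : V} (p : G.Walk u v) (hp : ∀ x ∈ p.support, x ∈ S → x = v) :
    expDist G S u v ≤ p.length :=
  sInf_le ⟨p, hp, rfl⟩

lemma expDist_self (v : V) : expDist G S v v = 0 := by
  simpa using expDist_le (S := S) (Walk.nil : G.Walk v v) (by simp)

lemma expDist_le_add_one {u u' : V} (v : V) (h : G.Adj u' u) (hu' : u' ∉ S) :
    expDist G S u' v ≤ expDist G S u v + 1 := by
  by_cases htop : expDist G S u v = ⊤
  · simp [htop]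
  · have hne : {n : ℕ∞ | ∃ p : G.Walk u v,
        (∀ x ∈ p.support, x ∈ S → x = v) ∧ (p.length : ℕ∞) = n}.Nonempty := by
      by_contra hne
      rw [Set.not_nonempty_iff_eq_empty] at hne
      exact htop (by rw [expDist, hne, sInf_empty])
    obtain ⟨p, hp, hlen⟩ := csInf_mem hne
    have hle := expDist_le (S := S) (Walk.cons h p) (by
      intro x hx hxS
      rw [Walk.support_cons, List.mem_cons] at hx
      rcases hx with rfl | hx
      · exact absurd hxS hu'
      · exact hp x hx hxS)
    rw [Walk.length_cons, Nat.cast_add, Nat.cast_one, hlen] at hle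
    exact hle

lemma expDist_le_one_of_adj {u v : V} (h : G.Adj u v) (hu : u ∉ S) : expDist G S u v ≤ 1 := by
  simpa [expDist_self] using expDist_le_add_one v h hu

lemma expDist_map_le {W : Type*} {H : SimpleGraph W} {R : Finset W} (f : H →g G)
    (hS : ∀ x, f x ∈ S → x ∈ R) (a b : W) :
    expDist G S (f a) (f b) ≤ expDist H R a b := by
  refine le_sInf ?_
  rintro _ ⟨p, hp, rfl⟩
  rw [← Walk.length_map f p]
  refine expDist_le _ fun x hx hxS ↦ ?_
  rw [Walk.support_map, List.mem_map] at hx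
  obtain ⟨y, hy, rfl⟩ := hx
  rw [hp y hy (hS y hxS)]

lemma two_le_expWeight_of_mem {v : V} (hv : v ∈ S) : 2 ≤ expWeight G S v := by
  have h := Finset.single_le_sum (f := fun w ↦ expStep (expDist G S v w))
    (fun w _ ↦ expStep_nonneg _) hv
  rwa [expDist_self, expStep_zero] at h

lemma one_le_expStep_of_adj {u v : V} (h : G.Adj u v) (hu : u ∉ S) :
    1 ≤ expStep (expDist G S u v) :=
  expStep_one.ge.trans (expStep_antitone (expDist_le_one_of_adj h hu))

lemma one_le_expWeight_of_adj {u v : V} (h : G.Adj u v) (hv : v ∈ S) : 1 ≤ expWeight G S u := by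
  by_cases hu : u ∈ S
  · linarith [two_le_expWeight_of_mem (G := G) hu]
  · exact (one_le_expStep_of_adj h hu).trans
      (Finset.single_le_sum (f := fun w ↦ expStep (expDist G S u w))
        (fun w _ ↦ expStep_nonneg _) hv)

lemma half_expWeight_le_of_adj {u u' : V} (h : G.Adj u' u) (hu' : u' ∉ S) :
    expWeight G S u / 2 ≤ expWeight G S u' := by
  rw [expWeight, Finset.sum_div]
  refine Finset.sum_le_sum fun v _ ↦ ?_
  rw [← expStep_add_one]
  exact expStep_antitone (expDist_le_add_one v h hu')

end expDist

lemma isExpDomSet_univ {V : Type*} [Fintype V] (G : SimpleGraph V) :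
    IsExpDomSet G Finset.univ :=
  fun v ↦ one_le_two.trans (two_le_expWeight_of_mem (Finset.mem_univ v))

lemma exists_isExpDomSet_card_eq {V : Type*} [Finite V] (G : SimpleGraph V) :
    ∃ S : Finset V, IsExpDomSet G S ∧ S.card = expDomNum G := by
  have := Fintype.ofFinite V
  exact Nat.sInf_mem (s := {k : ℕ | ∃ S : Finset V, IsExpDomSet G S ∧ S.card = k})
    ⟨_, Finset.univ, isExpDomSet_univ G, rfl⟩

lemma expDomNum_le_card {V : Type*} {G : SimpleGraph V} {S : Finset V} (hS : IsExpDomSet G S) :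
    expDomNum G ≤ S.card :=
  Nat.sInf_le ⟨S, hS, rfl⟩

lemma expWeight_add_le_cons_map {V : Type*} (G : SimpleGraph V) (s : Set V) (R : Finset s)
    {v : V} (hv : v ∉ s) (hvR : v ∉ R.map (Function.Embedding.subtype _)) (a : s) :
    expWeight (G.induce s) R a +
        expStep (expDist G (Finset.cons v (R.map (Function.Embedding.subtype _)) hvR) a v) ≤
      expWeight G (Finset.cons v (R.map (Function.Embedding.subtype _)) hvR) a := by
  rw [expWeight, expWeight, Finset.sum_cons, add_comm, Finset.sum_map]
  gcongr with b hb
  refine expStep_antitone (expDist_map_le (Embedding.induce (G := G) s).toHom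
    (fun x hx ↦ ?_) a b)
  rcases Finset.mem_cons.1 hx with h | h
  · exact absurd (h ▸ x.2) hv
  · obtain ⟨y, hy, hyx⟩ := Finset.mem_map.1 h
    rwa [← Subtype.ext hyx]

/-- Lemma 7(iii): if a vertex `u` of a tree `T` has two distinct neighbors `v₁`
and `v₂` such that `v₁` has degree `1`, `v₂` has degree `2`, and the neighbor
`v₂'` of `v₂` other than `u` has degree `1`, then
`γ_e(T) ≤ γ_e(T - {v₁, v₂, v₂'}) + 1`. -/
theorem expDomNum_le_delete_leaf_and_pendant_edge {V : Type*} [Fintype V]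
    [DecidableEq V] (T : SimpleGraph V) [DecidableRel T.Adj] (hT : T.IsTree)
    (u v₁ v₂ v₂' : V) (hne : v₁ ≠ v₂) (h1 : T.Adj u v₁) (h2 : T.Adj u v₂)
    (h2' : T.Adj v₂ v₂') (hne' : v₂' ≠ u)
    (hd1 : T.degree v₁ = 1) (hd2 : T.degree v₂ = 2) (hd2' : T.degree v₂' = 1) :
    expDomNum T ≤ expDomNum (T.induce {y : V | y ≠ v₁ ∧ y ≠ v₂ ∧ y ≠ v₂'}) + 1 := by
  set s : Set V := {y : V | y ≠ v₁ ∧ y ≠ v₂ ∧ y ≠ v₂'}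
  obtain ⟨R, hR, hcard⟩ := exists_isExpDomSet_card_eq (T.induce s)
  have hmem : ∀ x ∉ s, x ∉ R.map (Function.Embedding.subtype _) := by
    intro x hx h
    obtain ⟨y, -, rfl⟩ := Finset.mem_map.1 h
    exact hx y.2
  have hv₁ : v₁ ∉ s := fun h ↦ h.1 rfl
  have hv₂ : v₂ ∉ s := fun h ↦ h.2.1 rfl
  have hu : u ∈ s := ⟨h1.ne, h2.ne, hne'.symm⟩
  set S := Finset.cons v₂ (R.map (Function.Embedding.subtype _)) (hmem v₂ hv₂) with hS
  have hv₂S : v₂ ∈ S := Finset.mem_cons_self _ _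
  have hv₁S : v₁ ∉ S := fun h ↦ (Finset.mem_cons.1 h).elim hne (hmem v₁ hv₁)
  have hweight : ∀ a : s, 1 + expStep (expDist T S a v₂) ≤ expWeight T S a := fun a ↦
    (add_le_add_left (hR a) _).trans (expWeight_add_le_cons_map T s R hv₂ (hmem v₂ hv₂) a)
  have hu2 : 2 ≤ expWeight T S u := by
    by_cases huS : u ∈ S
    · exact two_le_expWeight_of_mem huS
    · linarith [hweight ⟨u, hu⟩, one_le_expStep_of_adj h2 huS]
  have hdom : IsExpDomSet T S := by
    intro x
    by_cases hx : x ∈ s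
    · linarith [hweight ⟨x, hx⟩, expStep_nonneg (expDist T S x v₂)]
    · have hx' : x = v₁ ∨ x = v₂ ∨ x = v₂' := by
        by_contra! h
        exact hx h
      rcases hx' with rfl | rfl | rfl
      · linarith [half_expWeight_le_of_adj h1.symm hv₁S]
      · exact one_le_two.trans (two_le_expWeight_of_mem hv₂S)
      · exact one_le_expWeight_of_adj h2'.symm hv₂S
  calc expDomNum T ≤ S.card := expDomNum_le_card hdom
    _ = expDomNum (T.induce s) + 1 := by rw [hS, Finset.card_cons, Finset.card_map, hcard]
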